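/- Embedding of CloM into CloG along the translation tr: for every formula ξ ∈ L_NF, if CloM ⊢ tr(ξ) then CloG ⊢ ξ. Here the names for the fixpoint variable x^φ are identified with the names for the fixpoint formula φ, and tr is extended to annotated formulas by tr(φ^a) = (tr φ)^a. -/

import Mathlib

/-! Normal-form game logic: syntax -/

mutual
inductive GLForm : Type where
  | atom  : ℕ → GLForm
  | natom : ℕ → GLForm
  | or    : GLForm → GLForm → GLForm
  | and   : GLForm → GLForm → GLForm
  | dia   : GLGame → GLForm → GLForm
inductive GLGame : Type where
  | atg   : ℕ → GLGame
  | atgd  : ℕ → GLGame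
  | comp  : GLGame → GLGame → GLGame
  | cha   : GLGame → GLGame → GLGame
  | chd   : GLGame → GLGame → GLGame
  | star  : GLGame → GLGame
  | cross : GLGame → GLGame
  | test  : GLForm → GLGame
  | dtest : GLForm → GLGame
end

noncomputable instance : DecidableEq GLForm := Classical.decEq _
noncomputable instance : DecidableEq GLGame := Classical.decEq _

/-! The (reflexive) subterm relation on game terms: `SubGG δ γ` means `δ` is a
    subterm of (or equal to) the game `γ`; `SubGF δ φ` means `δ` occurs as a
    subterm of the formula `φ`. -/

mutual
def SubGG : GLGame → GLGame → Prop
  | δ, .atg g  => δ = .atg g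
  | δ, .atgd g => δ = .atgd g
  | δ, .comp γ₁ γ₂ => δ = .comp γ₁ γ₂ ∨ SubGG δ γ₁ ∨ SubGG δ γ₂
  | δ, .cha γ₁ γ₂  => δ = .cha γ₁ γ₂ ∨ SubGG δ γ₁ ∨ SubGG δ γ₂
  | δ, .chd γ₁ γ₂  => δ = .chd γ₁ γ₂ ∨ SubGG δ γ₁ ∨ SubGG δ γ₂
  | δ, .star γ  => δ = .star γ ∨ SubGG δ γ
  | δ, .cross γ => δ = .cross γ ∨ SubGG δ γ
  | δ, .test φ  => δ = .test φ ∨ SubGF δ φ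
  | δ, .dtest φ => δ = .dtest φ ∨ SubGF δ φ
def SubGF : GLGame → GLForm → Prop
  | _, .atom _  => False
  | _, .natom _ => False
  | δ, .or φ ψ  => SubGF δ φ ∨ SubGF δ ψ
  | δ, .and φ ψ => SubGF δ φ ∨ SubGF δ ψ
  | δ, .dia γ φ => SubGG δ γ ∨ SubGF δ φ
end

/-! The annotated proof system CloG for game logic.

    A name for the greatest-fixpoint formula `⟨γ×⟩φ` is encoded as a pair
    `((γ×, φ), n)` with `n : ℕ`; thus distinct fixpoint formulas get disjoint
    countably infinite sets of names. -/

abbrev GName := (GLGame × GLForm) × ℕ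

/-- The order `⊑` on names, inherited from the order on fixpoint formulas:
    `x ⊑ y` iff the fixpoint game named by `y` is a subterm of the one named by `x`. -/
def GName.le (x y : GName) : Prop := SubGG y.1.1 x.1.1

/-- Annotations: non-repeating, `⊑`-monotone sequences of names. -/
def GAnnot (a : List GName) : Prop := a.Nodup ∧ a.Chain' GName.le

/-- `a ⊑ ⟨gm⟩φ`: every name in `a` names a fixpoint formula `⊑`-below-or-equal the
    fixpoint formula with game `gm`. -/
def annBelow (a : List GName) (gm : GLGame) : Prop := ∀ x ∈ a, SubGG gm x.1.1

abbrev GAnnForm := GLForm × List GName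
abbrev GASeq := Finset GAnnForm

/-- The name `x` does not occur in the (annotations of the) sequent `Φ`. -/
def GName.notIn (x : GName) (Φ : GASeq) : Prop := ∀ f ∈ Φ, x ∉ f.2

/-- `CloGDer A Φ`: the annotated sequent `Φ` is derivable in CloG from (open)
    assumptions in `A`.  The closure rule `clo` discharges its assumption.
    A CloG-proof of `Φ` is a derivation `CloGDer ∅ Φ`. -/
inductive CloGDer : Set GASeq → GASeq → Prop
  | hyp {A Φ} : Φ ∈ A → CloGDer A Φ
  | ax1 {A} (p : ℕ) : CloGDer A {(.atom p, []), (.natom p, [])}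
  | orR {A Φ φ ψ a} : CloGDer A (insert (φ, a) (insert (ψ, a) Φ)) →
      CloGDer A (insert (.or φ ψ, a) Φ)
  | andR {A Φ φ ψ a} : CloGDer A (insert (φ, a) Φ) → CloGDer A (insert (ψ, a) Φ) →
      CloGDer A (insert (.and φ ψ, a) Φ)
  | modm {A φ ψ a b g} : CloGDer A {(φ, a), (ψ, b)} →
      CloGDer A {(.dia (.atg g) φ, a), (.dia (.atgd g) ψ, b)}
  | chaR {A Φ γ δ φ a} : CloGDer A (insert (.or (.dia γ φ) (.dia δ φ), a) Φ) →
      CloGDer A (insert (.dia (.cha γ δ) φ, a) Φ)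
  | chdR {A Φ γ δ φ a} : CloGDer A (insert (.and (.dia γ φ) (.dia δ φ), a) Φ) →
      CloGDer A (insert (.dia (.chd γ δ) φ, a) Φ)
  | testR {A Φ ψ φ a} : CloGDer A (insert (.and ψ φ, a) Φ) →
      CloGDer A (insert (.dia (.test ψ) φ, a) Φ)
  | dtestR {A Φ ψ φ a} : CloGDer A (insert (.or ψ φ, a) Φ) →
      CloGDer A (insert (.dia (.dtest ψ) φ, a) Φ)
  | compR {A Φ γ δ φ a} : CloGDer A (insert (.dia γ (.dia δ φ), a) Φ) →
      CloGDer A (insert (.dia (.comp γ δ) φ, a) Φ)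
  | weak {A Φ φ a} : CloGDer A Φ → GAnnot a → CloGDer A (insert (φ, a) Φ)
  /-- expansion rule: from `Φ, φ^{ab}` derive `Φ, φ^{axb}` -/
  | expand {A Φ φ a b x} : CloGDer A (insert (φ, a ++ b) Φ) → GAnnot (a ++ x :: b) →
      CloGDer A (insert (φ, a ++ x :: b) Φ)
  | starR {A Φ γ φ a} : CloGDer A (insert (.or φ (.dia γ (.dia (.star γ) φ)), a) Φ) →
      annBelow a (.star γ) →
      CloGDer A (insert (.dia (.star γ) φ, a) Φ)
  | crossR {A Φ γ φ a} : CloGDer A (insert (.and φ (.dia γ (.dia (.cross γ) φ)), a) Φ) →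
      annBelow a (.cross γ) →
      CloGDer A (insert (.dia (.cross γ) φ, a) Φ)
  /-- closure rule `clo_x`, discharging the assumption `Φ, (⟨γ×⟩φ)^{ax}` -/
  | clo {A Φ γ φ a} (x : GName) :
      CloGDer (insert (insert (.dia (.cross γ) φ, a ++ [x]) Φ) A)
              (insert (.and φ (.dia γ (.dia (.cross γ) φ)), a ++ [x]) Φ) →
      x.1 = (.cross γ, φ) →
      annBelow a (.cross γ) →
      x ∉ a → x.notIn Φ →
      GAnnot (a ++ [x]) →
      CloGDer A (insert (.dia (.cross γ) φ, a) Φ)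

/-- `CloG ⊢ ξ` : there is a CloG-proof of `ξ^ε`. -/
def CloGProves (ξ : GLForm) : Prop := CloGDer ∅ {(ξ, [])}

/-! The monotone μ-calculus: syntax (in negation normal form), over a type `V`
    of fixpoint variables.  `dia g` is `⟨g⟩` and `box g` is `⟨g^d⟩`. -/

inductive MuForm (V : Type) : Type where
  | atom  : ℕ → MuForm V
  | natom : ℕ → MuForm V
  | var   : V → MuForm V
  | or    : MuForm V → MuForm V → MuForm V
  | and   : MuForm V → MuForm V → MuForm V
  | dia   : ℕ → MuForm V → MuForm V
  | box   : ℕ → MuForm V → MuForm V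
  | mu    : V → MuForm V → MuForm V
  | nu    : V → MuForm V → MuForm V

variable {V : Type}

/-- Free variables. -/
def MuForm.FV : MuForm V → Set V
  | .atom _  => ∅
  | .natom _ => ∅
  | .var x   => {x}
  | .or A B  => MuForm.FV A ∪ MuForm.FV B
  | .and A B => MuForm.FV A ∪ MuForm.FV B
  | .dia _ A => MuForm.FV A
  | .box _ A => MuForm.FV A
  | .mu x A  => MuForm.FV A \ {x}
  | .nu x A  => MuForm.FV A \ {x}

/-- All variables occurring (free or bound) in a formula. -/
def MuForm.vars : MuForm V → Set V
  | .atom _  => ∅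
  | .natom _ => ∅
  | .var x   => {x}
  | .or A B  => MuForm.vars A ∪ MuForm.vars B
  | .and A B => MuForm.vars A ∪ MuForm.vars B
  | .dia _ A => MuForm.vars A
  | .box _ A => MuForm.vars A
  | .mu x A  => insert x (MuForm.vars A)
  | .nu x A  => insert x (MuForm.vars A)

/-- `MuForm.Sub B A` : `B` is a subformula of `A` (reflexively). -/
def MuForm.Sub : MuForm V → MuForm V → Prop
  | B, .atom p  => B = .atom p
  | B, .natom p => B = .natom p
  | B, .var x   => B = .var x
  | B, .or A₁ A₂  => B = .or A₁ A₂ ∨ MuForm.Sub B A₁ ∨ MuForm.Sub B A₂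
  | B, .and A₁ A₂ => B = .and A₁ A₂ ∨ MuForm.Sub B A₁ ∨ MuForm.Sub B A₂
  | B, .dia g A => B = .dia g A ∨ MuForm.Sub B A
  | B, .box g A => B = .box g A ∨ MuForm.Sub B A
  | B, .mu x A  => B = .mu x A ∨ MuForm.Sub B A
  | B, .nu x A  => B = .nu x A ∨ MuForm.Sub B A

/-- `x <_C y` : `x` occurs freely in some subformula `σy.B` of `C`. -/
def ltV (C : MuForm V) (x y : V) : Prop :=
  ∃ B : MuForm V, (MuForm.Sub (.mu y B) C ∨ MuForm.Sub (.nu y B) C) ∧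
    x ∈ MuForm.FV (MuForm.mu y B)

/-- `≤_C` : the reflexive-transitive closure of `<_C`. -/
def leV (C : MuForm V) : V → V → Prop := Relation.ReflTransGen (ltV C)

/-- Local well-namedness: the transitive closure of `<_C` is irreflexive. -/
def LocallyWellNamed (C : MuForm V) : Prop := Irreflexive (Relation.TransGen (ltV C))

/-- Substitution of the formula `B` for the variable `x` (not binding-aware below
    binders of `x` itself). -/
def MuForm.subst [DecidableEq V] (x : V) (B : MuForm V) : MuForm V → MuForm V
  | .atom p  => .atom p
  | .natom p => .natom p
  | .var y   => if y = x then B else .var y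
  | .or A₁ A₂  => .or (MuForm.subst x B A₁) (MuForm.subst x B A₂)
  | .and A₁ A₂ => .and (MuForm.subst x B A₁) (MuForm.subst x B A₂)
  | .dia g A => .dia g (MuForm.subst x B A)
  | .box g A => .box g (MuForm.subst x B A)
  | .mu y A  => if y = x then .mu y A else .mu y (MuForm.subst x B A)
  | .nu y A  => if y = x then .nu y A else .nu y (MuForm.subst x B A)

noncomputable instance {V : Type} : DecidableEq (MuForm V) := Classical.decEq _

/-! The annotated proof system CloM[C] for the monotone μ-calculus.
    A name for the variable `x` is a pair `(x, n)` with `n : ℕ`. -/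

abbrev MName (V : Type) := V × ℕ

/-- The order on names inherited from `≤_C` on the variables they name. -/
def mNameLe (C : MuForm V) (x y : MName V) : Prop := leV C x.1 y.1

/-- Annotations: non-repeating, `≤_C`-monotone sequences of names. -/
def MAnnot (C : MuForm V) (a : List (MName V)) : Prop := a.Nodup ∧ a.Chain' (mNameLe C)

/-- Every name in `a` names a variable `≤_C x`. -/
def mBelow (C : MuForm V) (a : List (MName V)) (x : V) : Prop := ∀ n ∈ a, leV C n.1 x

abbrev MAnnForm (V : Type) := MuForm V × List (MName V)
abbrev MuSeq (V : Type) := Finset (MAnnForm V)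

/-- `CloMDer C A Γ`: the annotated sequent `Γ` is derivable in CloM[C] from (open)
    assumptions in `A`; the closure rule `nuClo` discharges its assumption.
    A CloM[C]-proof of `Γ` is a derivation `CloMDer C ∅ Γ`. -/
inductive CloMDer [DecidableEq V] (C : MuForm V) : Set (MuSeq V) → MuSeq V → Prop
  | hyp {A Γ} : Γ ∈ A → CloMDer C A Γ
  | ax1 {A} (p : ℕ) : CloMDer C A {(.atom p, []), (.natom p, [])}
  | orR {A Γ B₁ B₂ a} : CloMDer C A (insert (B₁, a) (insert (B₂, a) Γ)) →
      CloMDer C A (insert (.or B₁ B₂, a) Γ)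
  | andR {A Γ B₁ B₂ a} : CloMDer C A (insert (B₁, a) Γ) → CloMDer C A (insert (B₂, a) Γ) →
      CloMDer C A (insert (.and B₁ B₂, a) Γ)
  | modm {A B₁ B₂ a b g} : CloMDer C A {(B₁, a), (B₂, b)} →
      CloMDer C A {(.dia g B₁, a), (.box g B₂, b)}
  | weak {A Γ B a} : CloMDer C A Γ → MAnnot C a → CloMDer C A (insert (B, a) Γ)
  /-- expansion rule: from `Γ, B^{ab}` derive `Γ, B^{axb}` -/
  | expand {A Γ B a b x} : CloMDer C A (insert (B, a ++ b) Γ) → MAnnot C (a ++ x :: b) →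
      CloMDer C A (insert (B, a ++ x :: b) Γ)
  | muR {A Γ x B a} : CloMDer C A (insert (MuForm.subst x (.mu x B) B, a) Γ) →
      mBelow C a x →
      CloMDer C A (insert (.mu x B, a) Γ)
  | nuR {A Γ x B a} : CloMDer C A (insert (MuForm.subst x (.nu x B) B, a) Γ) →
      mBelow C a x →
      CloMDer C A (insert (.nu x B, a) Γ)
  /-- closure rule `ν-clo_x`, discharging the assumption `Γ, (νx.B)^{a nm}` -/
  | nuClo {A Γ x B a} (nm : MName V) :
      CloMDer C (insert (insert (.nu x B, a ++ [nm]) Γ) A)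
                (insert (MuForm.subst x (.nu x B) B, a ++ [nm]) Γ) →
      nm.1 = x →
      mBelow C a x →
      nm ∉ a → (∀ f ∈ Γ, nm ∉ f.2) →
      MAnnot C (a ++ [nm]) →
      CloMDer C A (insert (.nu x B, a) Γ)

/-- `CloM ⊢ A` : there is a CloM[A]-proof of `A^ε`. -/
def CloMProves [DecidableEq V] (A : MuForm V) : Prop := CloMDer A ∅ {(A, [])}
/-! The translation `tr` from normal-form game logic into the monotone μ-calculus.
    The fixpoint variable `x^{⟨γ∘⟩φ}` associated to a fixpoint formula `⟨γ∘⟩φ`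
    is encoded as the pair `(γ∘, φ)`. -/

/-- The type of fixpoint variables used by the translation. -/
abbrev GVar := GLGame × GLForm

mutual
/-- The translation `tr : L_NF → L^μ_NF`. -/
def trF : GLForm → MuForm GVar
  | .atom p  => .atom p
  | .natom p => .natom p
  | .or φ ψ  => .or (trF φ) (trF ψ)
  | .and φ ψ => .and (trF φ) (trF ψ)
  | .dia γ φ => trG φ γ (trF φ)
termination_by φ => sizeOf φ
/-- `trG φ γ A` is `τ_φ(γ)(A)`. -/
def trG : GLForm → GLGame → MuForm GVar → MuForm GVar
  | _, .atg g, A  => .dia g A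
  | _, .atgd g, A => .box g A
  | φ, .cha γ δ, A => .or (trG φ γ A) (trG φ δ A)
  | φ, .chd γ δ, A => .and (trG φ γ A) (trG φ δ A)
  | φ, .comp γ δ, A => trG (.dia δ φ) γ (trG φ δ A)
  | φ, .star γ, A =>
      .mu (GLGame.star γ, φ) (.or A (trG (.dia (.star γ) φ) γ (.var (GLGame.star γ, φ))))
  | φ, .cross γ, A =>
      .nu (GLGame.cross γ, φ) (.and A (trG (.dia (.cross γ) φ) γ (.var (GLGame.cross γ, φ))))
  | _, .test ψ, A  => .and (trF ψ) A
  | _, .dtest ψ, A => .or (trF ψ) A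
termination_by _ γ _ => sizeOf γ
end

/-! ### Subterm relation -/

theorem SubGG.refl (γ : GLGame) : SubGG γ γ := by
  cases γ <;> simp [SubGG]

mutual
theorem SubGG.trans {δ γ : GLGame} (h : SubGG δ γ) : ∀ η : GLGame, SubGG γ η → SubGG δ η
  | .atg _, k => by simp only [SubGG] at k; subst k; exact h
  | .atgd _, k => by simp only [SubGG] at k; subst k; exact h
  | .comp η₁ η₂, k => by
      rcases k with k | k | k
      · exact k ▸ h
      · exact Or.inr (Or.inl (SubGG.trans h η₁ k))
      · exact Or.inr (Or.inr (SubGG.trans h η₂ k))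
  | .cha η₁ η₂, k => by
      rcases k with k | k | k
      · exact k ▸ h
      · exact Or.inr (Or.inl (SubGG.trans h η₁ k))
      · exact Or.inr (Or.inr (SubGG.trans h η₂ k))
  | .chd η₁ η₂, k => by
      rcases k with k | k | k
      · exact k ▸ h
      · exact Or.inr (Or.inl (SubGG.trans h η₁ k))
      · exact Or.inr (Or.inr (SubGG.trans h η₂ k))
  | .star η, k => by
      rcases k with k | k
      · exact k ▸ h
      · exact Or.inr (SubGG.trans h η k)
  | .cross η, k => by
      rcases k with k | k
      · exact k ▸ h
      · exact Or.inr (SubGG.trans h η k)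
  | .test φ, k => by
      rcases k with k | k
      · exact k ▸ h
      · exact Or.inr (SubGF.trans h φ k)
  | .dtest φ, k => by
      rcases k with k | k
      · exact k ▸ h
      · exact Or.inr (SubGF.trans h φ k)
theorem SubGF.trans {δ γ : GLGame} (h : SubGG δ γ) : ∀ φ : GLForm, SubGF γ φ → SubGF δ φ
  | .atom _, k => k.elim
  | .natom _, k => k.elim
  | .or φ ψ, k => k.imp (SubGF.trans h φ) (SubGF.trans h ψ)
  | .and φ ψ, k => k.imp (SubGF.trans h φ) (SubGF.trans h ψ)
  | .dia γ φ, k => k.imp (SubGG.trans h γ) (SubGF.trans h φ)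
end

mutual
theorem SubGG.sizeOf_le {δ : GLGame} : ∀ η : GLGame, SubGG δ η → sizeOf δ ≤ sizeOf η
  | .atg _, k => by simp only [SubGG] at k; rw [k]
  | .atgd _, k => by simp only [SubGG] at k; rw [k]
  | .comp η₁ η₂, k => by
      rcases k with k | k | k
      · rw [k]
      · have := SubGG.sizeOf_le η₁ k; simp; omega
      · have := SubGG.sizeOf_le η₂ k; simp; omega
  | .cha η₁ η₂, k => by
      rcases k with k | k | k
      · rw [k]
      · have := SubGG.sizeOf_le η₁ k; simp; omega
      · have := SubGG.sizeOf_le η₂ k; simp; omega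
  | .chd η₁ η₂, k => by
      rcases k with k | k | k
      · rw [k]
      · have := SubGG.sizeOf_le η₁ k; simp; omega
      · have := SubGG.sizeOf_le η₂ k; simp; omega
  | .star η, k => by
      rcases k with k | k
      · rw [k]
      · have := SubGG.sizeOf_le η k; simp; omega
  | .cross η, k => by
      rcases k with k | k
      · rw [k]
      · have := SubGG.sizeOf_le η k; simp; omega
  | .test φ, k => by
      rcases k with k | k
      · rw [k]
      · have := SubGF.sizeOf_le φ k; simp; omega
  | .dtest φ, k => by
      rcases k with k | k
      · rw [k]
      · have := SubGF.sizeOf_le φ k; simp; omega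
theorem SubGF.sizeOf_le {δ : GLGame} : ∀ φ : GLForm, SubGF δ φ → sizeOf δ ≤ sizeOf φ
  | .atom _, k => k.elim
  | .natom _, k => k.elim
  | .or φ ψ, k => by
      rcases k with k | k
      · have := SubGF.sizeOf_le φ k; simp; omega
      · have := SubGF.sizeOf_le ψ k; simp; omega
  | .and φ ψ, k => by
      rcases k with k | k
      · have := SubGF.sizeOf_le φ k; simp; omega
      · have := SubGF.sizeOf_le ψ k; simp; omega
  | .dia γ φ, k => by
      rcases k with k | k
      · have := SubGG.sizeOf_le γ k; simp; omega
      · have := SubGF.sizeOf_le φ k; simp; omega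
end

theorem not_subGG_star (γ : GLGame) : ¬ SubGG (.star γ) γ := fun h => by
  have := SubGG.sizeOf_le γ h; simp at this

theorem not_subGG_cross (γ : GLGame) : ¬ SubGG (.cross γ) γ := fun h => by
  have := SubGG.sizeOf_le γ h; simp at this

/-! ### Free variables and substitution in translated formulas -/

mutual
theorem FV_trF : ∀ φ : GLForm, (trF φ).FV = ∅
  | .atom _ => by simp [trF, MuForm.FV]
  | .natom _ => by simp [trF, MuForm.FV]
  | .or φ ψ => by simp [trF, MuForm.FV, FV_trF φ, FV_trF ψ]
  | .and φ ψ => by simp [trF, MuForm.FV, FV_trF φ, FV_trF ψ]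
  | .dia γ φ => by
      have h := FV_trG γ φ (trF φ)
      rw [FV_trF φ] at h
      rw [trF]
      exact Set.subset_empty_iff.mp h
theorem FV_trG : ∀ (γ : GLGame) (φ : GLForm) (A : MuForm GVar), (trG φ γ A).FV ⊆ A.FV
  | .atg _, _, _ => by simp [trG, MuForm.FV]
  | .atgd _, _, _ => by simp [trG, MuForm.FV]
  | .comp γ δ, φ, A => by
      rw [trG]
      exact (FV_trG γ _ _).trans (FV_trG δ _ _)
  | .cha γ δ, φ, A => by
      simp only [trG, MuForm.FV]
      exact Set.union_subset (FV_trG γ _ _) (FV_trG δ _ _)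
  | .chd γ δ, φ, A => by
      simp only [trG, MuForm.FV]
      exact Set.union_subset (FV_trG γ _ _) (FV_trG δ _ _)
  | .star γ, φ, A => by
      simp only [trG, MuForm.FV]
      have h := FV_trG γ (.dia (.star γ) φ) (.var (.star γ, φ))
      rintro x ⟨hx | hx, hne⟩
      · exact hx
      · exact absurd (h hx) hne
  | .cross γ, φ, A => by
      simp only [trG, MuForm.FV]
      have h := FV_trG γ (.dia (.cross γ) φ) (.var (.cross γ, φ))
      rintro x ⟨hx | hx, hne⟩
      · exact hx
      · exact absurd (h hx) hne
  | .test ψ, φ, A => by simp [trG, MuForm.FV, FV_trF ψ]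
  | .dtest ψ, φ, A => by simp [trG, MuForm.FV, FV_trF ψ]
end

theorem MuForm.subst_of_notMem_FV [DecidableEq V] {x : V} {C : MuForm V} :
    ∀ {B : MuForm V}, x ∉ B.FV → subst x C B = B
  | .atom _, _ => rfl
  | .natom _, _ => rfl
  | .var y, h => by
      have : y ≠ x := fun e => h (by simp [FV, e])
      simp [subst, this]
  | .or A B, h => by
      simp only [FV, Set.mem_union, not_or] at h
      simp [subst, subst_of_notMem_FV h.1, subst_of_notMem_FV h.2]
  | .and A B, h => by
      simp only [FV, Set.mem_union, not_or] at h
      simp [subst, subst_of_notMem_FV h.1, subst_of_notMem_FV h.2]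
  | .dia _ A, h => by
      simp only [FV] at h
      simp [subst, subst_of_notMem_FV h]
  | .box _ A, h => by
      simp only [FV] at h
      simp [subst, subst_of_notMem_FV h]
  | .mu y A, h => by
      simp only [subst]
      split_ifs with e
      · rfl
      · rw [subst_of_notMem_FV fun hx => h ⟨hx, fun hxy => e (hxy ▸ rfl)⟩]
  | .nu y A, h => by
      simp only [subst]
      split_ifs with e
      · rfl
      · rw [subst_of_notMem_FV fun hx => h ⟨hx, fun hxy => e (hxy ▸ rfl)⟩]

theorem subst_trF (x : GVar) (C : MuForm GVar) (φ : GLForm) :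
    MuForm.subst x C (trF φ) = trF φ :=
  MuForm.subst_of_notMem_FV (by simp [FV_trF])

theorem subst_trG (x : GVar) (C : MuForm GVar) :
    ∀ (γ : GLGame) (φ : GLForm) (A : MuForm GVar), ¬ SubGG x.1 γ →
      MuForm.subst x C (trG φ γ A) = trG φ γ (MuForm.subst x C A)
  | .atg _, _, _, _ => by simp [trG, MuForm.subst]
  | .atgd _, _, _, _ => by simp [trG, MuForm.subst]
  | .comp γ δ, φ, A, h => by
      simp only [SubGG, not_or] at h
      rw [trG, subst_trG x C γ _ _ h.2.1, subst_trG x C δ _ _ h.2.2, trG]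
  | .cha γ δ, φ, A, h => by
      simp only [SubGG, not_or] at h
      simp only [trG, MuForm.subst]
      rw [subst_trG x C γ _ _ h.2.1, subst_trG x C δ _ _ h.2.2]
  | .chd γ δ, φ, A, h => by
      simp only [SubGG, not_or] at h
      simp only [trG, MuForm.subst]
      rw [subst_trG x C γ _ _ h.2.1, subst_trG x C δ _ _ h.2.2]
  | .star γ, φ, A, h => by
      simp only [SubGG, not_or] at h
      have hx : (GLGame.star γ, φ) ≠ x := fun e => h.1 (by rw [← e])
      simp only [trG, MuForm.subst, if_neg hx]
      rw [subst_trG x C γ _ _ h.2]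
      simp only [MuForm.subst, if_neg hx]
  | .cross γ, φ, A, h => by
      simp only [SubGG, not_or] at h
      have hx : (GLGame.cross γ, φ) ≠ x := fun e => h.1 (by rw [← e])
      simp only [trG, MuForm.subst, if_neg hx]
      rw [subst_trG x C γ _ _ h.2]
      simp only [MuForm.subst, if_neg hx]
  | .test ψ, φ, A, _ => by simp only [trG, MuForm.subst, subst_trF]
  | .dtest ψ, φ, A, _ => by simp only [trG, MuForm.subst, subst_trF]

/-- Unfolding the translation of `⟨γ*⟩φ` gives the translation of its unfolding. -/
theorem trF_star_unfold {γ : GLGame} {φ : GLForm} {x : GVar} {B : MuForm GVar}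
    (h : trF (.dia (.star γ) φ) = .mu x B) :
    MuForm.subst x (.mu x B) B = trF (.or φ (.dia γ (.dia (.star γ) φ))) := by
  have h' := h
  rw [trF, trG] at h'
  injection h' with hx hB
  rw [trF, trF, h, ← hB, ← hx]
  simp only [MuForm.subst, subst_trF]
  rw [subst_trG _ _ _ _ _ (not_subGG_star γ)]
  simp [MuForm.subst]

/-- Unfolding the translation of `⟨γ×⟩φ` gives the translation of its unfolding. -/
theorem trF_cross_unfold {γ : GLGame} {φ : GLForm} {x : GVar} {B : MuForm GVar}
    (h : trF (.dia (.cross γ) φ) = .nu x B) :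
    MuForm.subst x (.nu x B) B = trF (.and φ (.dia γ (.dia (.cross γ) φ))) := by
  have h' := h
  rw [trF, trG] at h'
  injection h' with hx hB
  rw [trF, trF, h, ← hB, ← hx]
  simp only [MuForm.subst, subst_trF]
  rw [subst_trG _ _ _ _ _ (not_subGG_cross γ)]
  simp [MuForm.subst]

/-! ### The variable order of a translated formula -/

/-- The order `<_A` refines the reversed subterm order on the games of the variables. -/
def VarOrdered (A : MuForm GVar) : Prop :=
  ∀ x y, ltV A x y → SubGG y.1 x.1

theorem varOrdered_iff {A : MuForm GVar} : VarOrdered A ↔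
    ∀ y B, (MuForm.Sub (.mu y B) A ∨ MuForm.Sub (.nu y B) A) →
      ∀ x ∈ (MuForm.mu y B).FV, SubGG y.1 x.1 :=
  ⟨fun h y B hs x hx => h x y ⟨B, hs, hx⟩, fun h x y ⟨B, hs, hx⟩ => h y B hs x hx⟩

theorem VarOrdered.or {A B : MuForm GVar} (hA : VarOrdered A) (hB : VarOrdered B) :
    VarOrdered (.or A B) := by
  rw [varOrdered_iff] at *
  intro y D hs
  simp only [MuForm.Sub, reduceCtorEq, false_or] at hs
  rcases hs with (h | h) | (h | h)
  exacts [hA y D (.inl h), hB y D (.inl h), hA y D (.inr h), hB y D (.inr h)]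

theorem VarOrdered.and {A B : MuForm GVar} (hA : VarOrdered A) (hB : VarOrdered B) :
    VarOrdered (.and A B) := by
  rw [varOrdered_iff] at *
  intro y D hs
  simp only [MuForm.Sub, reduceCtorEq, false_or] at hs
  rcases hs with (h | h) | (h | h)
  exacts [hA y D (.inl h), hB y D (.inl h), hA y D (.inr h), hB y D (.inr h)]

theorem VarOrdered.dia {g : ℕ} {A : MuForm GVar} (hA : VarOrdered A) :
    VarOrdered (.dia g A) := by
  rw [varOrdered_iff] at *
  simpa only [MuForm.Sub, reduceCtorEq, false_or] using hA

theorem VarOrdered.box {g : ℕ} {A : MuForm GVar} (hA : VarOrdered A) :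
    VarOrdered (.box g A) := by
  rw [varOrdered_iff] at *
  simpa only [MuForm.Sub, reduceCtorEq, false_or] using hA

theorem VarOrdered.mu {y : GVar} {A : MuForm GVar} (hA : VarOrdered A)
    (hy : ∀ x ∈ (MuForm.mu y A).FV, SubGG y.1 x.1) : VarOrdered (.mu y A) := by
  rw [varOrdered_iff] at *
  intro z D hs
  simp only [MuForm.Sub, reduceCtorEq, false_or] at hs
  rcases hs with (h | h) | h
  · injection h with h₁ h₂; subst h₁ h₂; exact hy
  exacts [hA z D (.inl h), hA z D (.inr h)]

theorem VarOrdered.nu {y : GVar} {A : MuForm GVar} (hA : VarOrdered A)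
    (hy : ∀ x ∈ (MuForm.mu y A).FV, SubGG y.1 x.1) : VarOrdered (.nu y A) := by
  rw [varOrdered_iff] at *
  intro z D hs
  simp only [MuForm.Sub, reduceCtorEq, false_or] at hs
  rcases hs with h | h | h
  · exact hA z D (.inl h)
  · injection h with h₁ h₂; subst h₁ h₂; exact hy
  · exact hA z D (.inr h)

theorem varOrdered_var (x : GVar) : VarOrdered (.var x) := by
  simp [varOrdered_iff, MuForm.Sub]

mutual
theorem varOrdered_trF : ∀ φ : GLForm, VarOrdered (trF φ)
  | .atom _ => by simp [varOrdered_iff, trF, MuForm.Sub]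
  | .natom _ => by simp [varOrdered_iff, trF, MuForm.Sub]
  | .or φ ψ => by rw [trF]; exact (varOrdered_trF φ).or (varOrdered_trF ψ)
  | .and φ ψ => by rw [trF]; exact (varOrdered_trF φ).and (varOrdered_trF ψ)
  | .dia γ φ => by
      rw [trF]
      exact varOrdered_trG γ φ _ (varOrdered_trF φ) (by simp [FV_trF])
theorem varOrdered_trG : ∀ (γ : GLGame) (φ : GLForm) (A : MuForm GVar), VarOrdered A →
    (∀ x ∈ A.FV, SubGG γ x.1) → VarOrdered (trG φ γ A)
  | .atg _, _, _, hA, _ => by rw [trG]; exact hA.dia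
  | .atgd _, _, _, hA, _ => by rw [trG]; exact hA.box
  | .comp γ δ, φ, A, hA, hx => by
      rw [trG]
      refine varOrdered_trG γ _ _ (varOrdered_trG δ _ _ hA fun x h => ?_) fun x h => ?_
      · exact SubGG.trans (by simp [SubGG, SubGG.refl]) _ (hx x h)
      · exact SubGG.trans (by simp [SubGG, SubGG.refl]) _ (hx x (FV_trG _ _ _ h))
  | .cha γ δ, φ, A, hA, hx => by
      rw [trG]
      refine (varOrdered_trG γ _ _ hA fun x h => ?_).or (varOrdered_trG δ _ _ hA fun x h => ?_) <;>
        exact SubGG.trans (by simp [SubGG, SubGG.refl]) _ (hx x h)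
  | .chd γ δ, φ, A, hA, hx => by
      rw [trG]
      refine (varOrdered_trG γ _ _ hA fun x h => ?_).and (varOrdered_trG δ _ _ hA fun x h => ?_) <;>
        exact SubGG.trans (by simp [SubGG, SubGG.refl]) _ (hx x h)
  | .star γ, φ, A, hA, hx => by
      have hfv := FV_trG (.star γ) φ A
      rw [trG] at hfv ⊢
      refine (hA.or (varOrdered_trG γ _ _ (varOrdered_var _) ?_)).mu fun x h => hx x (hfv h)
      rintro x rfl
      exact .inr (SubGG.refl γ)
  | .cross γ, φ, A, hA, hx => by
      have hfv := FV_trG (.cross γ) φ A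
      rw [trG] at hfv ⊢
      refine (hA.and (varOrdered_trG γ _ _ (varOrdered_var _) ?_)).nu fun x h => hx x (hfv h)
      rintro x rfl
      exact .inr (SubGG.refl γ)
  | .test ψ, φ, A, hA, _ => by rw [trG]; exact (varOrdered_trF ψ).and hA
  | .dtest ψ, φ, A, hA, _ => by rw [trG]; exact (varOrdered_trF ψ).or hA
end

theorem subGG_of_leV {C : MuForm GVar} (hC : VarOrdered C) {x y : GVar} (h : leV C x y) :
    SubGG y.1 x.1 := by
  induction h with
  | refl => exact SubGG.refl _
  | tail _ hyz ih => exact SubGG.trans (hC _ _ hyz) _ ih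

/-! ### The translation is finite-to-one -/

/-- The number of connectives of a formula. -/
def MuForm.size : MuForm V → ℕ
  | .atom _ => 0
  | .natom _ => 0
  | .var _ => 0
  | .or A B => A.size + B.size + 1
  | .and A B => A.size + B.size + 1
  | .dia _ A => A.size + 1
  | .box _ A => A.size + 1
  | .mu _ A => A.size + 1
  | .nu _ A => A.size + 1

theorem MuForm.Sub.refl (A : MuForm V) : MuForm.Sub A A := by
  cases A <;> simp [MuForm.Sub]

theorem MuForm.Sub.trans {A B : MuForm V} (h : MuForm.Sub A B) :
    ∀ {C : MuForm V}, MuForm.Sub B C → MuForm.Sub A C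
  | .atom _, k => by simp only [Sub] at k; subst k; exact h
  | .natom _, k => by simp only [Sub] at k; subst k; exact h
  | .var _, k => by simp only [Sub] at k; subst k; exact h
  | .or _ _, k => by
      rcases k with k | k | k
      exacts [k ▸ h, .inr (.inl (trans h k)), .inr (.inr (trans h k))]
  | .and _ _, k => by
      rcases k with k | k | k
      exacts [k ▸ h, .inr (.inl (trans h k)), .inr (.inr (trans h k))]
  | .dia _ _, k => by
      rcases k with k | k
      exacts [k ▸ h, .inr (trans h k)]
  | .box _ _, k => by
      rcases k with k | k
      exacts [k ▸ h, .inr (trans h k)]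
  | .mu _ _, k => by
      rcases k with k | k
      exacts [k ▸ h, .inr (trans h k)]
  | .nu _ _, k => by
      rcases k with k | k
      exacts [k ▸ h, .inr (trans h k)]

theorem MuForm.finite_sub : ∀ A : MuForm V, {B | MuForm.Sub B A}.Finite
  | .atom _ => by simp [Sub]
  | .natom _ => by simp [Sub]
  | .var _ => by simp [Sub]
  | .or A B => (((finite_sub A).union (finite_sub B)).insert (.or A B)).subset fun _ h => h
  | .and A B => (((finite_sub A).union (finite_sub B)).insert (.and A B)).subset fun _ h => h
  | .dia g A => ((finite_sub A).insert (.dia g A)).subset fun _ h => h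
  | .box g A => ((finite_sub A).insert (.box g A)).subset fun _ h => h
  | .mu x A => ((finite_sub A).insert (.mu x A)).subset fun _ h => h
  | .nu x A => ((finite_sub A).insert (.nu x A)).subset fun _ h => h

theorem sub_trG : ∀ (γ : GLGame) (φ : GLForm) (X : MuForm GVar), MuForm.Sub X (trG φ γ X)
  | .atg _, _, _ => by simp [trG, MuForm.Sub, MuForm.Sub.refl]
  | .atgd _, _, _ => by simp [trG, MuForm.Sub, MuForm.Sub.refl]
  | .comp γ δ, φ, X => by rw [trG]; exact (sub_trG δ φ X).trans (sub_trG γ _ _)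
  | .cha γ δ, φ, X => by rw [trG]; exact .inr (.inl (sub_trG γ φ X))
  | .chd γ δ, φ, X => by rw [trG]; exact .inr (.inl (sub_trG γ φ X))
  | .star γ, φ, X => by simp [trG, MuForm.Sub, MuForm.Sub.refl]
  | .cross γ, φ, X => by simp [trG, MuForm.Sub, MuForm.Sub.refl]
  | .test ψ, φ, X => by simp [trG, MuForm.Sub, MuForm.Sub.refl]
  | .dtest ψ, φ, X => by simp [trG, MuForm.Sub, MuForm.Sub.refl]

theorem size_lt_size_trG : ∀ (γ : GLGame) (φ : GLForm) (X : MuForm GVar),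
    X.size < (trG φ γ X).size
  | .atg _, _, _ => by simp [trG, MuForm.size]
  | .atgd _, _, _ => by simp [trG, MuForm.size]
  | .comp γ δ, φ, X => by
      rw [trG]; exact (size_lt_size_trG δ φ X).trans (size_lt_size_trG γ _ _)
  | .cha γ δ, φ, X => by
      have := size_lt_size_trG γ φ X
      simp only [trG, MuForm.size]; omega
  | .chd γ δ, φ, X => by
      have := size_lt_size_trG γ φ X
      simp only [trG, MuForm.size]; omega
  | .star γ, φ, X => by simp only [trG, MuForm.size]; omega
  | .cross γ, φ, X => by simp only [trG, MuForm.size]; omega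
  | .test ψ, φ, X => by simp only [trG, MuForm.size]; omega
  | .dtest ψ, φ, X => by simp only [trG, MuForm.size]; omega

theorem finite_setOf_trG_eq {n : ℕ}
    (hn : ∀ B : MuForm GVar, B.size < n → {ψ | trF ψ = B}.Finite) (k : ℕ) :
    ∀ (φ : GLForm) (X A : MuForm GVar), A.size ≤ n → A.size ≤ X.size + k →
      {γ | trG φ γ X = A}.Finite := by
  induction k with
  | zero =>
    intro φ X A _ hk
    refine Set.finite_empty.subset fun γ (hγ : trG φ γ X = A) => ?_
    have := size_lt_size_trG γ φ X
    rw [hγ] at this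
    omega
  | succ k ih =>
    intro φ X A hA hk
    have hcomp : {γ | ∃ γ₁ γ₂, γ = GLGame.comp γ₁ γ₂ ∧ trG φ γ X = A}.Finite := by
      have hY : {Y | MuForm.Sub Y A ∧ X.size < Y.size ∧ Y.size < A.size}.Finite :=
        (MuForm.finite_sub A).subset fun _ h => h.1
      refine (hY.biUnion (t := fun Y => ⋃ γ₂ ∈ {γ₂ | trG φ γ₂ X = Y},
        (fun γ₁ => GLGame.comp γ₁ γ₂) '' {γ₁ | trG (.dia γ₂ φ) γ₁ Y = A}) ?_).subset ?_
      · rintro Y ⟨-, hXY, hYA⟩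
        refine (ih φ X Y (by omega) (by omega)).biUnion fun γ₂ _ => ?_
        exact (ih (.dia γ₂ φ) Y A hA (by omega)).image _
      · rintro γ ⟨γ₁, γ₂, rfl, h⟩
        rw [trG] at h
        simp only [Set.mem_iUnion]
        refine ⟨trG φ γ₂ X, ⟨?_, size_lt_size_trG _ _ _, ?_⟩, γ₂, rfl, γ₁, h, rfl⟩
        · exact h ▸ sub_trG γ₁ _ _
        · exact h ▸ size_lt_size_trG γ₁ _ _
    suffices hrest : {γ | (¬ ∃ γ₁ γ₂, γ = GLGame.comp γ₁ γ₂) ∧ trG φ γ X = A}.Finite by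
      refine (hcomp.union hrest).subset fun γ (hγ : trG φ γ X = A) => ?_
      by_cases h : ∃ γ₁ γ₂, γ = GLGame.comp γ₁ γ₂
      · obtain ⟨γ₁, γ₂, h⟩ := h
        exact .inl ⟨γ₁, γ₂, h, hγ⟩
      · exact .inr ⟨h, hγ⟩
    cases A with
    | atom p =>
      refine Set.finite_empty.subset ?_
      rintro (_ | _ | _ | _ | _ | _ | _ | _ | _) ⟨h, h'⟩ <;> simp [trG] at h h'
    | natom p =>
      refine Set.finite_empty.subset ?_
      rintro (_ | _ | _ | _ | _ | _ | _ | _ | _) ⟨h, h'⟩ <;> simp [trG] at h h'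
    | var x =>
      refine Set.finite_empty.subset ?_
      rintro (_ | _ | _ | _ | _ | _ | _ | _ | _) ⟨h, h'⟩ <;> simp [trG] at h h'
    | dia g A =>
      refine (Set.finite_singleton (GLGame.atg g)).subset ?_
      rintro (_ | _ | _ | _ | _ | _ | _ | _ | _) ⟨h, h'⟩ <;> simp [trG] at h h' ⊢
      exact h'.1
    | box g A =>
      refine (Set.finite_singleton (GLGame.atgd g)).subset ?_
      rintro (_ | _ | _ | _ | _ | _ | _ | _ | _) ⟨h, h'⟩ <;> simp [trG] at h h' ⊢
      exact h'.1
    | mu x A =>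
      refine (Set.finite_singleton x.1).subset ?_
      rintro (_ | _ | _ | _ | _ | _ | _ | _ | _) ⟨h, h'⟩ <;> simp [trG] at h h' ⊢
      rw [← h'.1]
    | nu x A =>
      refine (Set.finite_singleton x.1).subset ?_
      rintro (_ | _ | _ | _ | _ | _ | _ | _ | _) ⟨h, h'⟩ <;> simp [trG] at h h' ⊢
      rw [← h'.1]
    | or A B =>
      simp only [MuForm.size] at hA hk
      have h₁ := ih φ X A (by omega) (by omega)
      have h₂ := ih φ X B (by omega) (by omega)
      refine ((Set.Finite.image2 GLGame.cha h₁ h₂).union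
        ((hn A (by omega)).image GLGame.dtest)).subset ?_
      rintro (_ | _ | _ | _ | _ | _ | _ | _ | _) ⟨h, h'⟩ <;> simp [trG] at h h' ⊢
      exacts [h', h'.1]
    | and A B =>
      simp only [MuForm.size] at hA hk
      have h₁ := ih φ X A (by omega) (by omega)
      have h₂ := ih φ X B (by omega) (by omega)
      refine ((Set.Finite.image2 GLGame.chd h₁ h₂).union
        ((hn A (by omega)).image GLGame.test)).subset ?_
      rintro (_ | _ | _ | _ | _ | _ | _ | _ | _) ⟨h, h'⟩ <;> simp [trG] at h h' ⊢
      exacts [h', h'.1]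

theorem finite_setOf_trF_eq (A : MuForm GVar) : {φ | trF φ = A}.Finite := by
  induction h : A.size using Nat.strong_induction_on generalizing A with
  | _ n ih =>
    subst h
    have hlt : ∀ B : MuForm GVar, B.size < A.size → {ψ | trF ψ = B}.Finite :=
      fun B hB => ih _ hB B rfl
    have hdia : {φ | ∃ γ ψ, φ = GLForm.dia γ ψ ∧ trF φ = A}.Finite := by
      have hY : {Y | MuForm.Sub Y A ∧ Y.size < A.size}.Finite :=
        (MuForm.finite_sub A).subset fun _ h => h.1
      refine (hY.biUnion (t := fun Y => ⋃ ψ ∈ {ψ | trF ψ = Y},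
        (fun γ => GLForm.dia γ ψ) '' {γ | trG ψ γ Y = A}) ?_).subset ?_
      · rintro Y ⟨-, hYA⟩
        refine (hlt Y hYA).biUnion fun ψ _ => ?_
        exact (finite_setOf_trG_eq hlt A.size ψ Y A le_rfl (by omega)).image _
      · rintro _ ⟨γ, ψ, rfl, h⟩
        rw [trF] at h
        simp only [Set.mem_iUnion]
        exact ⟨trF ψ, ⟨h ▸ sub_trG γ _ _, h ▸ size_lt_size_trG γ _ _⟩, ψ, rfl, γ, h, rfl⟩
    suffices hrest : {φ | (¬ ∃ γ ψ, φ = GLForm.dia γ ψ) ∧ trF φ = A}.Finite by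
      refine (hdia.union hrest).subset fun φ (hφ : trF φ = A) => ?_
      by_cases h : ∃ γ ψ, φ = GLForm.dia γ ψ
      · obtain ⟨γ, ψ, h⟩ := h
        exact .inl ⟨γ, ψ, h, hφ⟩
      · exact .inr ⟨h, hφ⟩
    cases A with
    | atom p =>
      refine (Set.finite_singleton (GLForm.atom p)).subset ?_
      rintro (_ | _ | _ | _ | _) ⟨h, h'⟩ <;> simp [trF] at h h' ⊢
      exact h'
    | natom p =>
      refine (Set.finite_singleton (GLForm.natom p)).subset ?_
      rintro (_ | _ | _ | _ | _) ⟨h, h'⟩ <;> simp [trF] at h h' ⊢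
      exact h'
    | or A B =>
      simp only [MuForm.size] at hlt
      refine (Set.Finite.image2 GLForm.or (hlt A (by omega)) (hlt B (by omega))).subset ?_
      rintro (_ | _ | _ | _ | _) ⟨h, h'⟩ <;> simp [trF] at h h' ⊢
      exact h'
    | and A B =>
      simp only [MuForm.size] at hlt
      refine (Set.Finite.image2 GLForm.and (hlt A (by omega)) (hlt B (by omega))).subset ?_
      rintro (_ | _ | _ | _ | _) ⟨h, h'⟩ <;> simp [trF] at h h' ⊢
      exact h'
    | _ =>
      refine Set.finite_empty.subset ?_
      rintro (_ | _ | _ | _ | _) ⟨h, hA⟩ <;> simp [trF] at h hA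

/-- The translation of annotated formulas. -/
noncomputable def trA (f : GAnnForm) : MAnnForm GVar := (trF f.1, f.2)

theorem finite_setOf_image_trA_eq (Γ : MuSeq GVar) :
    {Φ : GASeq | Φ.image trA = Γ}.Finite := by
  have hfib : (trA ⁻¹' (Γ : Set (MAnnForm GVar))).Finite := by
    refine Γ.finite_toSet.preimage' fun b _ => ?_
    refine ((finite_setOf_trF_eq b.1).image fun φ => (φ, b.2)).subset ?_
    rintro ⟨φ, a⟩ h
    obtain rfl : trA (φ, a) = b := h
    exact ⟨φ, rfl, rfl⟩
  refine hfib.toFinset.powerset.finite_toSet.subset fun Φ (hΦ : Φ.image trA = Γ) => ?_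
  simp only [Finset.coe_powerset, Set.mem_preimage, Set.mem_powerset_iff]
  intro f hf
  simpa using hΦ ▸ Finset.mem_image_of_mem trA hf

/-! ### Structural properties of CloG -/

theorem CloGDer.mono {A B : Set GASeq} {Φ : GASeq} (h : CloGDer A Φ) (hAB : A ⊆ B) :
    CloGDer B Φ := by
  induction h generalizing B with
  | hyp h => exact .hyp (hAB h)
  | ax1 p => exact .ax1 p
  | orR _ ih => exact .orR (ih hAB)
  | andR _ _ ih₁ ih₂ => exact .andR (ih₁ hAB) (ih₂ hAB)
  | modm _ ih => exact .modm (ih hAB)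
  | chaR _ ih => exact .chaR (ih hAB)
  | chdR _ ih => exact .chdR (ih hAB)
  | testR _ ih => exact .testR (ih hAB)
  | dtestR _ ih => exact .dtestR (ih hAB)
  | compR _ ih => exact .compR (ih hAB)
  | weak _ ha ih => exact .weak (ih hAB) ha
  | expand _ ha ih => exact .expand (ih hAB) ha
  | starR _ ha ih => exact .starR (ih hAB) ha
  | crossR _ ha ih => exact .crossR (ih hAB) ha
  | clo x _ hx hb hxa hxΦ ha ih =>
    exact .clo x (ih (Set.insert_subset_insert hAB)) hx hb hxa hxΦ ha

/-- All annotations of the sequent are well-formed. -/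
def WellAnnotated (Φ : GASeq) : Prop := ∀ f ∈ Φ, GAnnot f.2

theorem WellAnnotated.insert {Φ : GASeq} (hΦ : WellAnnotated Φ) {φ : GLForm}
    {a : List GName} (ha : GAnnot a) : WellAnnotated (insert (φ, a) Φ) := by
  intro f hf
  rcases Finset.mem_insert.mp hf with rfl | hf
  exacts [ha, hΦ f hf]

theorem CloGDer.weaken {A : Set GASeq} {Φ Ψ : GASeq} (h : CloGDer A Φ) (hΦΨ : Φ ⊆ Ψ)
    (hΨ : WellAnnotated Ψ) : CloGDer A Ψ := by
  have key : ∀ Θ : GASeq, WellAnnotated Θ → CloGDer A (Θ ∪ Φ) := by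
    intro Θ
    induction Θ using Finset.induction_on with
    | empty => intro _; simpa using h
    | insert f Θ _ ih =>
      intro hΘ
      rw [Finset.insert_union]
      exact .weak (ih fun g hg => hΘ g (Finset.mem_insert_of_mem hg))
        (hΘ f (Finset.mem_insert_self _ _))
  simpa [Finset.union_eq_left.mpr hΦΨ] using key Ψ hΨ

theorem GAnnot.of_sublist {a b : List GName} (hb : GAnnot b) (h : a.Sublist b) : GAnnot a := by
  have : IsTrans GName GName.le := ⟨fun x y z hxy hyz => SubGG.trans hyz _ hxy⟩
  exact ⟨hb.1.sublist h, hb.2.sublist h⟩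

/-- Formulas that are either Boolean or a modality with an atomic or fixpoint game. -/
inductive IsHead : GLForm → Prop
  | atom (p) : IsHead (.atom p)
  | natom (p) : IsHead (.natom p)
  | or (φ ψ) : IsHead (.or φ ψ)
  | and (φ ψ) : IsHead (.and φ ψ)
  | atg (g φ) : IsHead (.dia (.atg g) φ)
  | atgd (g φ) : IsHead (.dia (.atgd g) φ)
  | star (γ φ) : IsHead (.dia (.star γ) φ)
  | cross (γ φ) : IsHead (.dia (.cross γ) φ)

/-- `φ` can be inferred from `φ'` in every context, with the same annotation. -/
def Reduces (φ φ' : GLForm) : Prop :=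
  ∀ (A : Set GASeq) (Φ : GASeq) (a : List GName),
    CloGDer A (insert (φ', a) Φ) → CloGDer A (insert (φ, a) Φ)

theorem exists_head_dia : ∀ (γ : GLGame) (φ : GLForm),
    ∃ φ', IsHead φ' ∧ trF φ' = trF (.dia γ φ) ∧ Reduces (.dia γ φ) φ'
  | .atg g, φ => ⟨_, .atg g φ, rfl, fun _ _ _ => id⟩
  | .atgd g, φ => ⟨_, .atgd g φ, rfl, fun _ _ _ => id⟩
  | .comp γ δ, φ => by
      obtain ⟨φ', h, e, r⟩ := exists_head_dia γ (.dia δ φ)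
      exact ⟨φ', h, by rw [e]; simp only [trF, trG], fun A Φ a d => .compR (r A Φ a d)⟩
  | .cha γ δ, φ => ⟨_, .or _ _, by simp only [trF, trG], fun _ _ _ => .chaR⟩
  | .chd γ δ, φ => ⟨_, .and _ _, by simp only [trF, trG], fun _ _ _ => .chdR⟩
  | .star γ, φ => ⟨_, .star γ φ, rfl, fun _ _ _ => id⟩
  | .cross γ, φ => ⟨_, .cross γ φ, rfl, fun _ _ _ => id⟩
  | .test ψ, φ => ⟨_, .and ψ φ, by simp only [trF, trG], fun _ _ _ => .testR⟩
  | .dtest ψ, φ => ⟨_, .or ψ φ, by simp only [trF, trG], fun _ _ _ => .dtestR⟩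

theorem exists_head : ∀ φ : GLForm, ∃ φ', IsHead φ' ∧ trF φ' = trF φ ∧ Reduces φ φ'
  | .atom p => ⟨_, .atom p, rfl, fun _ _ _ => id⟩
  | .natom p => ⟨_, .natom p, rfl, fun _ _ _ => id⟩
  | .or φ ψ => ⟨_, .or φ ψ, rfl, fun _ _ _ => id⟩
  | .and φ ψ => ⟨_, .and φ ψ, rfl, fun _ _ _ => id⟩
  | .dia γ φ => exists_head_dia γ φ

/-- A formula of the sequent can be replaced by its head form, keeping the sequent as context. -/
theorem exists_head_mem {Φ : GASeq} {B : MuForm GVar} {a : List GName}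
    (h : (B, a) ∈ Φ.image trA) :
    ∃ φ', IsHead φ' ∧ trF φ' = B ∧
      ∀ A : Set GASeq, CloGDer A (insert (φ', a) Φ) → CloGDer A Φ := by
  obtain ⟨⟨φ, b⟩, hf, he⟩ := Finset.mem_image.mp h
  simp only [trA, Prod.mk.injEq] at he
  obtain ⟨rfl, rfl⟩ := he
  obtain ⟨φ', h₁, h₂, h₃⟩ := exists_head φ
  refine ⟨φ', h₁, h₂, fun A d => ?_⟩
  simpa [Finset.insert_eq_of_mem hf] using h₃ A Φ b d

theorem WellAnnotated.of_mem_image {Φ : GASeq} (hΦ : WellAnnotated Φ) {B : MuForm GVar}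
    {a : List GName} (h : (B, a) ∈ Φ.image trA) : GAnnot a := by
  obtain ⟨f, hf, he⟩ := Finset.mem_image.mp h
  obtain rfl : f.2 = a := congrArg Prod.snd he
  exact hΦ f hf

/-! ### Simulation of CloM in CloG -/

/-- Every well-annotated sequent whose translation contains `Γ` is derivable from `H`. -/
def Simulates (H : Set GASeq) (Γ : MuSeq GVar) : Prop :=
  ∀ Φ : GASeq, WellAnnotated Φ → Γ ⊆ Φ.image trA → CloGDer H Φ

theorem Simulates.mono {H H' : Set GASeq} {Γ : MuSeq GVar} (h : Simulates H Γ) (hH : H ⊆ H') :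
    Simulates H' Γ :=
  fun Φ hΦ hΓ => (h Φ hΦ hΓ).mono hH

theorem image_trA_filter {Φ : GASeq} {Γ : MuSeq GVar} (hΓ : Γ ⊆ Φ.image trA) :
    (Φ.filter fun f => trA f ∈ Γ).image trA = Γ := by
  ext b
  simp only [Finset.mem_image, Finset.mem_filter]
  constructor
  · rintro ⟨f, ⟨-, hf⟩, rfl⟩
    exact hf
  · intro hb
    obtain ⟨f, hf, rfl⟩ := Finset.mem_image.mp (hΓ hb)
    exact ⟨f, ⟨hf, hb⟩, rfl⟩

/-- The closure rule of CloM is simulated by nested instances of the closure rule of CloG, one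
for each sequent translating to the discharged one. -/
theorem simulates_nuClo {S : Set (MuSeq GVar)} {Γ : MuSeq GVar} {x : GVar} {B : MuForm GVar}
    {a : List GName} {nm : GName} (hnm : nm.1 = x) (hbelow : annBelow a x.1) (hna : nm ∉ a)
    (hnΓ : ∀ f ∈ Γ, nm ∉ f.2) (hann : GAnnot (a ++ [nm]))
    (ih : ∀ H : Set GASeq,
      (∀ Γ' ∈ insert (insert (.nu x B, a ++ [nm]) Γ) S, Simulates H Γ') →
        Simulates H (insert (MuForm.subst x (.nu x B) B, a ++ [nm]) Γ))
    {H : Set GASeq} (hH : ∀ Γ' ∈ S, Simulates H Γ') :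
    Simulates H (insert (.nu x B, a) Γ) := by
  have step : ∀ H : Set GASeq, (∀ Γ' ∈ S, Simulates H Γ') → ∀ (γ : GLGame) (φ : GLForm)
      (Φ : GASeq), trF (.dia (.cross γ) φ) = .nu x B → WellAnnotated Φ → Φ.image trA = Γ →
      Simulates (insert (insert (.dia (.cross γ) φ, a ++ [nm]) Φ) H)
        (insert (.nu x B, a ++ [nm]) Γ) →
      CloGDer H (insert (.dia (.cross γ) φ, a) Φ) := by
    intro H hH γ φ Φ hφ hΦ hΦΓ hsim
    have hx : x = (.cross γ, φ) := by
      have h' := hφ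
      rw [trF, trG] at h'
      injection h' with h' _
      exact h'.symm
    refine .clo nm ?_ (hnm.trans hx) (by simpa [hx] using hbelow) hna ?_ hann
    · refine ih _ ?_ _ (hΦ.insert hann) ?_
      · rintro Γ' (rfl | hΓ')
        exacts [hsim, (hH Γ' hΓ').mono (Set.subset_insert _ _)]
      · rw [Finset.image_insert, hΦΓ, trF_cross_unfold hφ]
        rfl
    · exact fun f hf => hnΓ (trA f) (hΦΓ ▸ Finset.mem_image_of_mem trA hf)
  have loop : ∀ (n : ℕ) (H : Set GASeq), (∀ Γ' ∈ S, Simulates H Γ') →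
      ({Φ : GASeq | Φ.image trA = insert (.nu x B, a ++ [nm]) Γ} \ H).ncard ≤ n →
      Simulates H (insert (.nu x B, a ++ [nm]) Γ) := by
    intro n
    induction n with
    | zero => ?_
    | succ n ihn => ?_
    all_goals
      intro H hH hn Φ hΦ hΓ
      obtain ⟨φ', hh, he, hd⟩ := exists_head_mem (hΓ (Finset.mem_insert_self _ _))
      cases hh <;> simp only [trF, trG, reduceCtorEq] at he
      rename_i γ φ
      have he' : trF (.dia (.cross γ) φ) = .nu x B := by rw [trF, trG, he]
      have hΓ' : Γ ⊆ Φ.image trA := (Finset.subset_insert _ _).trans hΓ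
      have himg : (insert (.dia (.cross γ) φ, a ++ [nm])
          (Φ.filter fun f => trA f ∈ Γ)).image trA = insert (.nu x B, a ++ [nm]) Γ := by
        rw [Finset.image_insert, image_trA_filter hΓ', trA, he']
      refine hd H (CloGDer.weaken ?_ (Finset.insert_subset_insert _
        (Finset.filter_subset (fun f => trA f ∈ Γ) Φ)) (hΦ.insert hann))
      by_cases hmem : insert (.dia (.cross γ) φ, a ++ [nm]) (Φ.filter fun f => trA f ∈ Γ) ∈ H
      · exact .hyp hmem
      have hfin := (finite_setOf_image_trA_eq (insert (.nu x B, a ++ [nm]) Γ)).sdiff (t := H)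
    · exact (Set.eq_empty_iff_forall_notMem.mp
        ((Set.ncard_eq_zero hfin).mp (Nat.le_zero.mp hn)) _ ⟨himg, hmem⟩).elim
    · refine .expand (b := []) ?_ hann
      rw [List.append_nil]
      refine step H hH γ φ _ he' (fun f hf => hΦ f (Finset.filter_subset _ _ hf)) ?_ ?_
      · simpa using image_trA_filter hΓ'
      · refine ihn _ (fun Γ' h => (hH Γ' h).mono (Set.subset_insert _ _)) ?_
        have hlt := Set.ncard_lt_ncard (s := {Φ : GASeq | Φ.image trA =
          insert (.nu x B, a ++ [nm]) Γ} \ insert (insert (.dia (.cross γ) φ, a ++ [nm])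
            (Φ.filter fun f => trA f ∈ Γ)) H) ⟨Set.sdiff_subset_sdiff_right (Set.subset_insert _ _),
              fun hsub => (hsub ⟨himg, hmem⟩).2 (Set.mem_insert _ _)⟩ hfin
        omega
  intro Φ hΦ hΓ
  obtain ⟨φ', hh, he, hd⟩ := exists_head_mem (hΓ (Finset.mem_insert_self _ _))
  have ha := hΦ.of_mem_image (hΓ (Finset.mem_insert_self _ _))
  cases hh <;> simp only [trF, trG, reduceCtorEq] at he
  rename_i γ φ
  have he' : trF (.dia (.cross γ) φ) = .nu x B := by rw [trF, trG, he]
  have hΓ' : Γ ⊆ Φ.image trA := (Finset.subset_insert _ _).trans hΓ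
  refine hd H (CloGDer.weaken ?_ (Finset.insert_subset_insert _
    (Finset.filter_subset (fun f => trA f ∈ Γ) Φ)) (hΦ.insert ha))
  refine step H hH γ φ _ he' (fun f hf => hΦ f (Finset.filter_subset _ _ hf))
    (image_trA_filter hΓ') ?_
  exact loop _ _ (fun Γ' h => (hH Γ' h).mono (Set.subset_insert _ _)) le_rfl

theorem CloMDer.simulates {C : MuForm GVar} (hC : VarOrdered C) {S : Set (MuSeq GVar)}
    {Γ : MuSeq GVar} (h : CloMDer C S Γ) :
    ∀ H : Set GASeq, (∀ Γ' ∈ S, Simulates H Γ') → Simulates H Γ := by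
  induction h with
  | hyp h => exact fun H hH => hH _ h
  | ax1 p =>
    intro H _ Φ hΦ hΓ
    obtain ⟨φ₁, h₁, e₁, d₁⟩ := exists_head_mem (hΓ (Finset.mem_insert_self _ _))
    have hnil : GAnnot [] := ⟨List.nodup_nil, List.isChain_nil⟩
    cases h₁ <;> simp only [trF, trG, reduceCtorEq, MuForm.atom.injEq] at e₁
    subst e₁
    refine d₁ H ?_
    obtain ⟨φ₂, h₂, e₂, d₂⟩ := exists_head_mem (Finset.image_subset_image
      (Finset.subset_insert _ Φ) (hΓ (Finset.mem_insert_of_mem (Finset.mem_singleton_self _))))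
    cases h₂ <;> simp only [trF, trG, reduceCtorEq, MuForm.natom.injEq] at e₂
    rename_i q
    subst e₂
    refine d₂ H ((CloGDer.ax1 q).weaken ?_ ((hΦ.insert hnil).insert hnil))
    intro f hf
    simp only [Finset.mem_insert, Finset.mem_singleton] at hf ⊢
    tauto
  | orR _ ih =>
    intro H hH Φ hΦ hΓ
    have hmem := hΓ (Finset.mem_insert_self _ _)
    have ha := hΦ.of_mem_image hmem
    obtain ⟨φ', h, e, d⟩ := exists_head_mem hmem
    cases h <;> simp only [trF, trG, reduceCtorEq, MuForm.or.injEq] at e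
    obtain ⟨rfl, rfl⟩ := e
    refine d H (.orR (ih H hH _ ((hΦ.insert ha).insert ha) ?_))
    simp only [Finset.image_insert]
    exact Finset.insert_subset_insert _ (Finset.insert_subset_insert _
      ((Finset.subset_insert _ _).trans hΓ))
  | andR _ _ ih₁ ih₂ =>
    intro H hH Φ hΦ hΓ
    have hmem := hΓ (Finset.mem_insert_self _ _)
    have ha := hΦ.of_mem_image hmem
    obtain ⟨φ', h, e, d⟩ := exists_head_mem hmem
    cases h <;> simp only [trF, trG, reduceCtorEq, MuForm.and.injEq] at e
    obtain ⟨rfl, rfl⟩ := e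
    refine d H (.andR (ih₁ H hH _ (hΦ.insert ha) ?_) (ih₂ H hH _ (hΦ.insert ha) ?_))
    all_goals
      rw [Finset.image_insert]
      exact Finset.insert_subset_insert _ ((Finset.subset_insert _ _).trans hΓ)
  | @modm _ B₁ B₂ a b g _ ih =>
    intro H hH Φ hΦ hΓ
    have hmem₁ := hΓ (Finset.mem_insert_self _ _)
    have hmem₂ := hΓ (Finset.mem_insert_of_mem (Finset.mem_singleton_self _))
    have ha := hΦ.of_mem_image hmem₁
    have hb := hΦ.of_mem_image hmem₂
    obtain ⟨φ₁, h₁, e₁, d₁⟩ := exists_head_mem hmem₁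
    cases h₁ <;> simp only [trF, trG, reduceCtorEq, MuForm.dia.injEq] at e₁
    rename_i g₁ φ₁
    obtain ⟨rfl, rfl⟩ := e₁
    refine d₁ H ?_
    obtain ⟨φ₂, h₂, e₂, d₂⟩ := exists_head_mem (Φ := insert (.dia (.atg g₁) φ₁, a) Φ)
      (Finset.image_subset_image (Finset.subset_insert _ _) hmem₂)
    cases h₂ <;> simp only [trF, trG, reduceCtorEq, MuForm.box.injEq] at e₂
    rename_i g₂ φ₂
    obtain ⟨rfl, rfl⟩ := e₂
    refine d₂ H (CloGDer.weaken (.modm (g := g₂) (ih H hH {(φ₁, a), (φ₂, b)} ?_ ?_)) ?_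
      ((hΦ.insert ha).insert hb))
    · intro f hf
      simp only [Finset.mem_insert, Finset.mem_singleton] at hf
      rcases hf with rfl | rfl
      exacts [ha, hb]
    · simp [Finset.image_insert, trA]
    · intro f hf
      simp only [Finset.mem_insert, Finset.mem_singleton] at hf ⊢
      tauto
  | weak _ _ ih =>
    exact fun H hH Φ hΦ hΓ => ih H hH Φ hΦ ((Finset.subset_insert _ _).trans hΓ)
  | @expand _ _ B a b x _ _ ih =>
    intro H hH Φ hΦ hΓ
    obtain ⟨⟨φ, c⟩, hf, he⟩ := Finset.mem_image.mp (hΓ (Finset.mem_insert_self _ _))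
    simp only [trA, Prod.mk.injEq] at he
    obtain ⟨rfl, rfl⟩ := he
    have hann : GAnnot (a ++ x :: b) := hΦ _ hf
    rw [← Finset.insert_eq_of_mem hf]
    refine .expand (ih H hH _ (hΦ.insert (hann.of_sublist ?_)) ?_) hann
    · exact (List.sublist_cons_self x b).append_left a
    · rw [Finset.image_insert]
      exact Finset.insert_subset_insert _ ((Finset.subset_insert _ _).trans hΓ)
  | muR _ hbelow ih =>
    intro H hH Φ hΦ hΓ
    have hmem := hΓ (Finset.mem_insert_self _ _)
    have ha := hΦ.of_mem_image hmem
    obtain ⟨φ', h, e, d⟩ := exists_head_mem hmem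
    have e' := e
    cases h <;> simp only [trF, trG, reduceCtorEq, MuForm.mu.injEq] at e
    refine d H (.starR (ih H hH _ (hΦ.insert ha) ?_) fun n hn => ?_)
    · rw [Finset.image_insert, trF_star_unfold e']
      exact Finset.insert_subset_insert _ ((Finset.subset_insert _ _).trans hΓ)
    · have := subGG_of_leV hC (hbelow n hn)
      rwa [← e.1] at this
  | nuR _ hbelow ih =>
    intro H hH Φ hΦ hΓ
    have hmem := hΓ (Finset.mem_insert_self _ _)
    have ha := hΦ.of_mem_image hmem
    obtain ⟨φ', h, e, d⟩ := exists_head_mem hmem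
    have e' := e
    cases h <;> simp only [trF, trG, reduceCtorEq, MuForm.nu.injEq] at e
    refine d H (.crossR (ih H hH _ (hΦ.insert ha) ?_) fun n hn => ?_)
    · rw [Finset.image_insert, trF_cross_unfold e']
      exact Finset.insert_subset_insert _ ((Finset.subset_insert _ _).trans hΓ)
    · have := subGG_of_leV hC (hbelow n hn)
      rwa [← e.1] at this
  | nuClo nm _ hnm hbelow hna hnΓ hann ih =>
    exact fun H hH => simulates_nuClo hnm (fun n hn => subGG_of_leV hC (hbelow n hn)) hna hnΓ
      ⟨hann.1, hann.2.imp fun _ _ h => subGG_of_leV hC h⟩ ih hH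

/-- Embedding of `CloM` into `CloG` along the translation `tr`:
    for every `ξ ∈ L_NF`, if `CloM ⊢ tr(ξ)` then `CloG ⊢ ξ`.  The names for the
    fixpoint variable `x^φ = (γ∘, φ')` are identified with the names for the
    fixpoint formula `φ = ⟨γ∘⟩φ'` (both are pairs `((γ∘, φ'), n)`), and `tr`
    extends to annotated formulas by `tr(φ^a) = (tr φ)^a`. -/
theorem CloM_to_CloG (ξ : GLForm) :
    CloMProves (trF ξ) → CloGProves ξ := by
  intro h
  refine CloMDer.simulates (varOrdered_trF ξ) h ∅ (by simp) _ ?_ ?_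
  · intro f hf
    rw [Finset.mem_singleton.mp hf]
    exact ⟨List.nodup_nil, List.isChain_nil⟩
  · simp [trA]
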